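/- arXiv:1909.07135 — 2 statements merged into one kernel-verified Lean document; each statement's English description precedes it below -/
import Mathlib

section
/- Let K be a field of characteristic 0, let (A, σ) be a finite-dimensional K-algebra with involution, let J be the Jacobson radical of A, and let σ̄ be the involution induced by σ on Ā = A/J (note J^σ = J). Then: (i) (Ā, σ̄) factors as a product ∏_{i=1}^t (A_i, σ_i) of simple K-algebras with involution; and (ii) there exist positive rational numbers α_1, …, α_t (viewed in K) such that the involution-trace form q_{A,σ} is isometric to α_1 q_{A_1,σ_1} ⊕ ⋯ ⊕ α_t q_{A_t,σ_t} ⊕ ⟨0,…,0⟩. -/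
open Module

/-- The involution-trace form `q_{A,σ}(x) = Tr_{A/K}(x^σ x)`. -/
noncomputable def involutionTraceForm (K : Type*) {A : Type*} [Field K] [Ring A]
    [Algebra K A] (σ : A → A) : A → K :=
  fun x => LinearMap.trace K A (LinearMap.mulLeft K (σ x * x))

section helpers



theorem trace_exact {K N M Q : Type*} [Field K] [AddCommGroup M] [Module K M]
    [FiniteDimensional K M] [AddCommGroup N] [Module K N] [FiniteDimensional K N]
    [AddCommGroup Q] [Module K Q] [FiniteDimensional K Q]
    (i : N →ₗ[K] M) (p : M →ₗ[K] Q) (hi : Function.Injective i) (hp : Function.Surjective p)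
    (hip : LinearMap.ker p = LinearMap.range i) (f : M →ₗ[K] M) (g : N →ₗ[K] N)
    (h : Q →ₗ[K] Q) (hg : ∀ x : N, i (g x) = f (i x))
    (hh : ∀ x : M, h (p x) = p (f x)) :
    LinearMap.trace K M f = LinearMap.trace K N g + LinearMap.trace K Q h := by
  obtain ⟨pr, hpr⟩ := LinearMap.exists_leftInverse_of_injective i (LinearMap.ker_eq_bot.2 hi)
  obtain ⟨s0, hs0⟩ := LinearMap.exists_rightInverse_of_surjective p (LinearMap.range_eq_top.2 hp)
  have hpr' : ∀ x : N, pr (i x) = x := fun x => LinearMap.congr_fun hpr x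
  have hs0' : ∀ x, p (s0 x) = x := fun x => LinearMap.congr_fun hs0 x
  have hpi : ∀ x, p (i x) = 0 := fun x => by
    have : i x ∈ LinearMap.ker p := hip ▸ LinearMap.mem_range_self i x
    exact this
  let s : Q →ₗ[K] M := (LinearMap.id - i ∘ₗ pr) ∘ₗ s0
  have hs : ∀ x, s (p x) = x - i (pr x) := fun x => by
    have : s0 (p x) - x ∈ LinearMap.ker p := by simp [hs0']
    rw [hip] at this
    obtain ⟨z, hz⟩ := this
    have : s0 (p x) = x + i z := by rw [hz]; abel
    simp [s, this, hpr']
  have hid : f = f ∘ₗ (i ∘ₗ pr) + f ∘ₗ (s ∘ₗ p) := by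
    ext x
    simp only [LinearMap.add_apply, LinearMap.comp_apply, hs, ← map_add]
    simp
  conv_lhs => rw [hid, map_add]
  congr 1
  · rw [← LinearMap.comp_assoc, LinearMap.trace_comp_comm']
    congr 1
    ext x
    simp only [LinearMap.comp_apply]
    rw [← hg, hpr']
  · rw [← LinearMap.comp_assoc, LinearMap.trace_comp_comm']
    congr 1
    refine LinearMap.ext fun y => ?_
    obtain ⟨x, rfl⟩ := hp y
    simp only [LinearMap.comp_apply, hs, map_sub, hh]
    rw [← hg, hpi, sub_zero]

theorem field_trace {K F V : Type*} [Field K] [Field F] [Algebra K F] [FiniteDimensional K F]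
    [AddCommGroup V] [Module K V] [FiniteDimensional K V] (r : F →ₗ[K] End K V) (h1 : r 1 = 1)
    (hm : ∀ x y, r (x * y) = r x * r y) (x : F) :
    (finrank K F : K) * LinearMap.trace K V (r x) = finrank K V * Algebra.trace K F x := by
  let r' : F →+* End K V := ⟨⟨⟨r, h1⟩, hm⟩, by simp, by simp⟩
  let _ : Module F V := Module.compHom V r'
  have hsm : ∀ (c : F) (v : V), c • v = r c v := fun _ _ => rfl
  have : IsScalarTower K F V := ⟨fun k c v => by simp [hsm]⟩
  have : Module.Finite F V := Module.Finite.of_restrictScalars_finite K F V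
  let b := Module.finBasis F V
  let s : Fin (finrank F V) → F →ₗ[K] V := fun i =>
    (LinearMap.toSpanSingleton F V (b i)).restrictScalars K
  let c : Fin (finrank F V) → V →ₗ[K] F := fun i => (b.coord i).restrictScalars K
  have hid : r x = ∑ i, r x ∘ₗ s i ∘ₗ c i := by
    ext v
    simp only [LinearMap.sum_apply, LinearMap.comp_apply, ← map_sum]
    congr 1
    exact (b.sum_repr v).symm
  have ht : LinearMap.trace K V (r x) = finrank F V * Algebra.trace K F x := by
    rw [hid, map_sum]
    have : ∀ i, LinearMap.trace K V (r x ∘ₗ s i ∘ₗ c i) = Algebra.trace K F x := fun i => by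
      rw [← LinearMap.comp_assoc, LinearMap.trace_comp_comm', Algebra.trace_apply]
      congr 1
      ext y
      simp only [LinearMap.comp_apply, s, c]
      simp [← hsm]
    simp [this]
  rw [ht, ← Module.finrank_mul_finrank K F V]
  push_cast
  ring

theorem matrix_trace_fn {K D : Type*} [Field K] [DivisionRing D] [Algebra K D] {n : ℕ} [NeZero n]
    (τ : Matrix (Fin n) (Fin n) D →ₗ[K] K) (hτ : ∀ x y, τ (x * y) = τ (y * x))
    (x : Matrix (Fin n) (Fin n) D) :
    (n : K) * τ x = τ (Matrix.scalar (Fin n) x.trace) := by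
  have h1 : ∀ i j (d : D), i ≠ j → τ (Matrix.single i j d) = 0 := fun i j d hij => by
    have := hτ (Matrix.single i i 1) (Matrix.single i j d)
    rw [Matrix.single_mul_single_same, Matrix.single_mul_single_of_ne _ _ _ _ (Ne.symm hij)] at this
    simpa using this
  have h2 : ∀ i j (d : D), τ (Matrix.single i i d) = τ (Matrix.single j j d) := fun i j d => by
    have := hτ (Matrix.single i j d) (Matrix.single j i 1)
    simpa [Matrix.single_mul_single_same] using this
  have hs : ∀ d : D, τ (Matrix.scalar (Fin n) d) = n * τ (Matrix.single 0 0 d) := fun d => by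
    have : Matrix.scalar (Fin n) d = ∑ i, Matrix.single i i d := by
      ext a b
      simp [Matrix.sum_apply, Matrix.single_apply, Matrix.diagonal_apply]
      by_cases hab : a = b
      · simp [hab]
      · rw [if_neg hab]
        refine (Finset.sum_eq_zero fun c _ => if_neg ?_).symm
        rintro ⟨rfl, rfl⟩
        exact hab rfl
    rw [this, map_sum, Finset.sum_congr rfl (fun i _ => h2 i 0 d)]
    simp
  rw [hs]
  congr 1
  have hx : τ x = ∑ i, ∑ j, τ (Matrix.single i j (x i j)) := by
    conv_lhs => rw [Matrix.matrix_eq_sum_single x]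
    simp only [map_sum]
  rw [hx]
  have e : Matrix.single (0 : Fin n) (0 : Fin n) x.trace = ∑ i, Matrix.single 0 0 (x i i) := by
    rw [← Matrix.singleAddMonoidHom_apply, Matrix.trace, map_sum]; rfl
  refine Eq.trans ?_ ((congrArg τ e).trans (map_sum _ _ _)).symm
  refine Finset.sum_congr rfl fun i _ => ?_
  rw [Finset.sum_eq_single i]
  · exact h2 _ _ _
  · intro j _ hj; exact h1 _ _ _ (Ne.symm hj)
  · simp

set_option linter.deprecated false in
theorem key_trace {K D V : Type*} [Field K] [CharZero K] [DivisionRing D] [Algebra K D]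
    [FiniteDimensional K D] {n : ℕ} [NeZero n]
    [AddCommGroup V] [Module K V] [FiniteDimensional K V]
    (r : Matrix (Fin n) (Fin n) D →ₗ[K] End K V) (h1 : r 1 = 1)
    (hm : (∀ x y, r (x * y) = r x * r y) ∨ (∀ x y, r (x * y) = r y * r x))
    (x : Matrix (Fin n) (Fin n) D) :
    (finrank K (Matrix (Fin n) (Fin n) D) : K) * LinearMap.trace K V (r x) =
      finrank K V * LinearMap.trace K _ (LinearMap.mulLeft K x) := by
  have hn : (n : K) ≠ 0 := by exact_mod_cast NeZero.ne n
  have e1 := matrix_trace_fn (LinearMap.trace K V ∘ₗ r) (fun x y => by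
    rcases hm with hm | hm <;>
    · simp only [LinearMap.comp_apply, hm]
      exact LinearMap.trace_mul_comm _ _ _) x
  have e2 := matrix_trace_fn (LinearMap.trace K _ ∘ₗ LinearMap.mul K (Matrix (Fin n) (Fin n) D))
    (fun x y => by
      simp only [LinearMap.comp_apply]
      have : ∀ a b : Matrix (Fin n) (Fin n) D, LinearMap.mul K _ (a * b) =
        LinearMap.mul K _ a * LinearMap.mul K _ b := fun a b => by ext; simp [mul_assoc]
      rw [this, this]
      exact LinearMap.trace_mul_comm _ _ _) x
  simp only [LinearMap.comp_apply] at e1 e2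
  have e3 : ∀ d : D, (finrank K (Matrix (Fin n) (Fin n) D) : K) *
      LinearMap.trace K V (r (Matrix.scalar (Fin n) d)) =
      finrank K V * LinearMap.trace K _ (LinearMap.mul K _ (Matrix.scalar (Fin n) d)) := by
    intro d
    let S := Algebra.adjoin K {d}
    let _ : CommRing S := Algebra.adjoinCommRingOfComm K (by
      intro a ha b hb
      simp only [Set.mem_singleton_iff] at ha hb
      rw [ha, hb])
    have : IsDomain S := inferInstance
    have : FiniteDimensional K S := inferInstance
    have hf : IsField S := isField_of_isIntegral_of_isField' (R := K) (Field.toIsField K)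
    let _ : Field S := hf.toField
    let ι : S →ₗ[K] Matrix (Fin n) (Fin n) D := 
      (Matrix.scalarAlgHom (Fin n) K).toLinearMap ∘ₗ S.val.toLinearMap
    have hι1 : ι 1 = 1 := by simp [ι]
    have hιm : ∀ a b, ι (a * b) = ι a * ι b := fun a b => by simp [ι]
    have hιd : ι ⟨d, Algebra.self_mem_adjoin_singleton K d⟩ = Matrix.scalar (Fin n) d := rfl
    have f1 := field_trace (r ∘ₗ ι) (by simp [hι1, h1]) (fun a b => by
      rcases hm with hm | hm
      · simp [hιm, hm]
      · rw [mul_comm]; simp [hιm, hm]) ⟨d, Algebra.self_mem_adjoin_singleton K d⟩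
    have f2 := field_trace (LinearMap.mul K (Matrix (Fin n) (Fin n) D) ∘ₗ ι) 
      (by ext; simp [hι1]) (fun a b => by
        refine LinearMap.ext fun y => ?_
        simp [hιm, mul_assoc]) ⟨d, Algebra.self_mem_adjoin_singleton K d⟩
    simp only [LinearMap.comp_apply, hιd] at f1 f2
    have hS : (finrank K S : K) ≠ 0 := by exact_mod_cast (Module.finrank_pos (R := K) (M := S)).ne'
    apply mul_left_cancel₀ hS
    linear_combination (finrank K (Matrix (Fin n) (Fin n) D) : K) * f1 - (finrank K V : K) * f2
  apply mul_left_cancel₀ hn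
  have e4 := e3 x.trace
  have e5 : LinearMap.mulLeft K x = LinearMap.mul K _ x := rfl
  rw [e5]
  linear_combination e4 + (finrank K (Matrix (Fin n) (Fin n) D) : K) * e1 - (finrank K V : K) * e2

universe v

/-- The trace of the action of `a` on a module. -/
noncomputable def modTr (K : Type*) {A : Type*} (M : Type*) [Field K] [Ring A] [Algebra K A]
    [AddCommGroup M] [Module K M] [Module A M] [IsScalarTower K A M] : A → K :=
  fun a => LinearMap.trace K M (Algebra.lsmul K K M a)

theorem modTr_exact {K A : Type*} (M : Type*) [Field K] [Ring A] [Algebra K A]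
    [AddCommGroup M] [Module K M] [Module A M] [IsScalarTower K A M] [FiniteDimensional K M]
    (N : Submodule A M) : modTr K (A := A) M = modTr K N + modTr K (M ⧸ N) := by
  have : FiniteDimensional K N :=
    inferInstanceAs (FiniteDimensional K (N.restrictScalars K))
  have : FiniteDimensional K (M ⧸ N) :=
    Module.Finite.of_surjective (N.mkQ.restrictScalars K) N.mkQ_surjective
  funext a
  refine trace_exact (N.subtype.restrictScalars K) (N.mkQ.restrictScalars K)
    N.subtype_injective N.mkQ_surjective ?_ _ _ _ ?_ ?_
  · ext x; simp
  · intro x; simp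
  · intro x; simp

theorem mod_induction {K : Type*} {A : Type v} [Field K] [Ring A] [Algebra K A]
    (S : Set A) (P : (A → K) → Prop) (P0 : P 0) (Padd : ∀ f g, P f → P g → P (f + g))
    (hs : ∀ (M : Type v) [AddCommGroup M] [Module K M] [Module A M] [IsScalarTower K A M]
      [FiniteDimensional K M] [IsSimpleModule A M], (∀ s ∈ S, ∀ m : M, s • m = 0) →
      P (modTr K M)) (k : ℕ) :
    ∀ (M : Type v) [AddCommGroup M] [Module K M] [Module A M] [IsScalarTower K A M]
      [FiniteDimensional K M], (∀ s ∈ S, ∀ m : M, s • m = 0) → finrank K M ≤ k →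
      P (modTr K M) := by
  induction k with
  | zero =>
    intro M _ _ _ _ _ _ hk
    have : Subsingleton M := Module.finrank_zero_iff.1 (Nat.le_zero.1 hk)
    have : modTr K (A := A) M = 0 := by
      funext a
      have : Algebra.lsmul K K M a = 0 := Subsingleton.elim _ _
      simp [modTr, this]
    rw [this]; exact P0
  | succ k ih =>
    intro M _ _ _ _ _ hS hk
    by_cases hM : Subsingleton M
    · exact ih M hS (by rw [Module.finrank_zero_iff.2 hM]; omega)
    have : Nontrivial M := not_subsingleton_iff_nontrivial.1 hM
    by_cases hsim : ∀ N : Submodule A M, N = ⊥ ∨ N = ⊤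
    · have : IsSimpleOrder (Submodule A M) := ⟨hsim⟩
      have : IsSimpleModule A M := ⟨⟩
      exact hs M hS
    push Not at hsim
    obtain ⟨N, hN1, hN2⟩ := hsim
    have : FiniteDimensional K N :=
      inferInstanceAs (FiniteDimensional K (N.restrictScalars K))
    have : FiniteDimensional K (M ⧸ N) :=
      Module.Finite.of_surjective (N.mkQ.restrictScalars K) N.mkQ_surjective
    have hadd : finrank K N + finrank K (M ⧸ N) = finrank K M := by
      have h1 := (N.mkQ.restrictScalars K).finrank_range_add_finrank_ker
      have h0 : LinearMap.range (N.mkQ.restrictScalars K) = ⊤ :=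
        LinearMap.range_eq_top.2 N.mkQ_surjective
      rw [h0, finrank_top] at h1
      have h2 : LinearMap.ker (N.mkQ.restrictScalars K) = N.restrictScalars K := by
        ext x; simp
      rw [h2] at h1
      have h3 : finrank K (N.restrictScalars K) = finrank K N := rfl
      omega
    have : Nontrivial N := (Submodule.nontrivial_iff_ne_bot).2 hN1
    have : Nontrivial (M ⧸ N) := Submodule.Quotient.nontrivial_iff.2 hN2
    have hp1 : 0 < finrank K N := Module.finrank_pos
    have hp2 : 0 < finrank K (M ⧸ N) := Module.finrank_pos
    rw [modTr_exact M N]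
    refine Padd _ _ (ih N ?_ (by omega)) (ih (M ⧸ N) ?_ (by omega))
    · intro s hs m
      apply Subtype.ext
      simpa using hS s hs m
    · intro s hs m
      obtain ⟨m, rfl⟩ := N.mkQ_surjective m
      rw [← map_smul, hS s hs, map_zero]

theorem exists_unit_preimage {A B : Type*} [Ring A] [Ring B] [IsSimpleRing B] (p : A →+* B)
    (hp : Function.Surjective p) (L : Ideal A) (hL : ∀ x ∈ L, ∀ a, x * a ∈ L) (x : A)
    (hx : x ∈ L) (hpx : p x ≠ 0) : ∃ u ∈ L, p u = 1 := by
  have h := (isSimpleRing_iff_isTwoSided_imp.1 (inferInstanceAs (IsSimpleRing B))).2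
    (L.map p) ⟨fun {a} b ha => by
      rw [Ideal.mem_map_iff_of_surjective p hp] at ha ⊢
      obtain ⟨y, hy, rfl⟩ := ha
      obtain ⟨c, rfl⟩ := hp b
      exact ⟨y * c, hL y hy c, map_mul _ _ _⟩⟩
  have hmem : p x ∈ L.map p := Ideal.mem_map_of_mem p hx
  rcases h with h | h
  · rw [h] at hmem; exact absurd hmem hpx
  · have : (1 : B) ∈ L.map p := by rw [h]; trivial
    exact (Ideal.mem_map_iff_of_surjective p hp).1 this

section simple
variable {K : Type*} {A : Type v} [Field K] [CharZero K] [Ring A] [Algebra K A]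
  {D : Type*} [DivisionRing D] [Algebra K D] [FiniteDimensional K D] {n : ℕ} [NeZero n]

theorem modTr_of_ker (p : A →ₐ[K] Matrix (Fin n) (Fin n) D) (hp : Function.Surjective p)
    (M : Type*) [AddCommGroup M] [Module K M] [Module A M] [IsScalarTower K A M]
    [FiniteDimensional K M] (hM : ∀ a, p a = 0 → ∀ m : M, a • m = 0) :
    ∃ c : ℚ, 0 ≤ c ∧ ∀ y : A, modTr K M y =
      (c : K) * LinearMap.trace K _ (LinearMap.mulLeft K (p y)) := by
  obtain ⟨s, hs⟩ := LinearMap.exists_rightInverse_of_surjective p.toLinearMap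
    (LinearMap.range_eq_top.2 hp)
  have hs' : ∀ b, p (s b) = b := fun b => LinearMap.congr_fun hs b
  have hr : ∀ a a', p a = p a' → Algebra.lsmul K K M a = Algebra.lsmul K K M a' := by
    intro a a' h
    ext m
    have := hM (a - a') (by simp [h]) m
    rw [sub_smul, sub_eq_zero] at this
    simpa using this
  have hB : (finrank K (Matrix (Fin n) (Fin n) D) : K) ≠ 0 := by
    exact_mod_cast (Module.finrank_pos (R := K) (M := Matrix (Fin n) (Fin n) D)).ne'
  refine ⟨finrank K M / finrank K (Matrix (Fin n) (Fin n) D), by positivity, fun y => ?_⟩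
  have := key_trace ((Algebra.lsmul K K M).toLinearMap ∘ₗ s)
    (by
      have := hr (s 1) 1 (by simp [hs'])
      simp only [LinearMap.comp_apply, AlgHom.toLinearMap_apply, this, map_one])
    (Or.inl fun x y => by
      simp only [LinearMap.comp_apply, AlgHom.toLinearMap_apply]
      rw [← map_mul]
      exact hr _ _ (by simp [hs'])) (p y)
  simp only [LinearMap.comp_apply, AlgHom.toLinearMap_apply] at this
  rw [hr (s (p y)) y (hs' _)] at this
  push_cast
  rw [div_mul_eq_mul_div, eq_div_iff hB, ← this, mul_comm]
  rfl

theorem modTr_of_ker_anti (σ : A →ₗ[K] A) (hmul : ∀ x y : A, σ (x * y) = σ y * σ x)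
    (h1 : σ 1 = 1)
    (p : A →ₐ[K] Matrix (Fin n) (Fin n) D) (hp : Function.Surjective p)
    (M : Type*) [AddCommGroup M] [Module K M] [Module A M] [IsScalarTower K A M]
    [FiniteDimensional K M] (hM : ∀ a, p a = 0 → ∀ m : M, σ a • m = 0) :
    ∃ c : ℚ, 0 ≤ c ∧ ∀ y : A, σ y = y → modTr K M y =
      (c : K) * LinearMap.trace K _ (LinearMap.mulLeft K (p y)) := by
  obtain ⟨s, hs⟩ := LinearMap.exists_rightInverse_of_surjective p.toLinearMap
    (LinearMap.range_eq_top.2 hp)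
  have hs' : ∀ b, p (s b) = b := fun b => LinearMap.congr_fun hs b
  have hr : ∀ a a', p a = p a' → Algebra.lsmul K K M (σ a) = Algebra.lsmul K K M (σ a') := by
    intro a a' h
    ext m
    have := hM (a - a') (by simp [h]) m
    rw [map_sub, sub_smul, sub_eq_zero] at this
    simpa using this
  have hB : (finrank K (Matrix (Fin n) (Fin n) D) : K) ≠ 0 := by
    exact_mod_cast (Module.finrank_pos (R := K) (M := Matrix (Fin n) (Fin n) D)).ne'
  refine ⟨finrank K M / finrank K (Matrix (Fin n) (Fin n) D), by positivity, fun y hy => ?_⟩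
  have := key_trace ((Algebra.lsmul K K M).toLinearMap ∘ₗ σ ∘ₗ s)
    (by
      have := hr (s 1) 1 (by simp [hs'])
      simp only [LinearMap.comp_apply, AlgHom.toLinearMap_apply, this, map_one, h1])
    (Or.inr fun x y => by
      simp only [LinearMap.comp_apply, AlgHom.toLinearMap_apply]
      rw [← map_mul, ← hmul]
      exact hr _ _ (by simp [hs'])) (p y)
  simp only [LinearMap.comp_apply, AlgHom.toLinearMap_apply] at this
  rw [hr (s (p y)) y (hs' _), hy] at this
  push_cast
  rw [div_mul_eq_mul_div, eq_div_iff hB, ← this, mul_comm]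
  rfl

/-- The `σ`-stable ideal attached to `p`. -/
def sigmaIdeal (σ : A →ₗ[K] A) (hmul : ∀ x y : A, σ (x * y) = σ y * σ x)
    {B : Type*} [Ring B] [Algebra K B] (p : A →ₐ[K] B) : Ideal A where
  carrier := {x | p x = 0 ∧ p (σ x) = 0}
  add_mem' := by
    rintro a b ⟨h1, h2⟩ ⟨h3, h4⟩
    simp [h1, h2, h3, h4]
  zero_mem' := by simp
  smul_mem' := by
    rintro a b ⟨h1, h2⟩
    simp [h1, h2, hmul]

theorem simple_modTr (σ : A →ₗ[K] A) (hmul : ∀ x y : A, σ (x * y) = σ y * σ x)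
    (hinvol : ∀ x, σ (σ x) = x) (h1 : σ 1 = 1)
    (p : A →ₐ[K] Matrix (Fin n) (Fin n) D) (hp : Function.Surjective p)
    (M : Type*) [AddCommGroup M] [Module K M] [Module A M] [IsScalarTower K A M]
    [FiniteDimensional K M] [IsSimpleModule A M]
    (hM : ∀ a ∈ sigmaIdeal σ hmul p, ∀ m : M, a • m = 0) :
    ∃ c : ℚ, 0 ≤ c ∧ ∀ y : A, σ y = y → modTr K M y =
      (c : K) * LinearMap.trace K _ (LinearMap.mulLeft K (p y)) := by
  by_cases hk : ∀ a, p a = 0 → ∀ m : M, a • m = 0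
  · obtain ⟨c, hc, h⟩ := modTr_of_ker p hp M hk
    exact ⟨c, hc, fun y _ => h y⟩
  · push Not at hk
    obtain ⟨a, ha, m, ham⟩ := hk
    refine modTr_of_ker_anti σ hmul h1 p hp M ?_
    let N : Submodule A M :=
      { carrier := {m | ∀ b, p b = 0 → σ b • m = 0}
        add_mem' := fun {x y} hx hy b hb => by rw [smul_add, hx b hb, hy b hb, add_zero]
        zero_mem' := fun b hb => smul_zero _
        smul_mem' := fun c x hx b hb => by
          have := hx (σ c * b) (by simp [hb])
          rwa [hmul, hinvol, mul_smul] at this }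
    have hmem : a • m ∈ N := fun b hb => by
      rw [← mul_smul]
      exact hM _ ⟨by simp [ha], by simp [hmul, hinvol, hb]⟩ m
    have hN : N = ⊤ := by
      rcases eq_bot_or_eq_top N with h | h
      · rw [h] at hmem; exact absurd hmem ham
      · exact h
    intro b hb m
    have : m ∈ N := by rw [hN]; trivial
    exact this b hb

theorem sigma_quot_modTr [FiniteDimensional K A]
    (σ : A →ₗ[K] A) (hmul : ∀ x y : A, σ (x * y) = σ y * σ x)
    (hinvol : ∀ x, σ (σ x) = x) (h1 : σ 1 = 1)
    (p : A →ₐ[K] Matrix (Fin n) (Fin n) D) (hp : Function.Surjective p) :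
    ∃ c : ℚ, 0 ≤ c ∧ ∀ y : A, σ y = y →
      LinearMap.trace K _ (LinearMap.mulLeft K (p y)) =
      (c : K) * modTr K (A ⧸ sigmaIdeal σ hmul p) y := by
  have key : ∃ c : ℚ, 0 ≤ c ∧ ∀ y : A, σ y = y → modTr K (A ⧸ sigmaIdeal σ hmul p) y =
      (c : K) * LinearMap.trace K _ (LinearMap.mulLeft K (p y)) := by
    refine mod_induction (sigmaIdeal σ hmul p : Set A)
      (fun f => ∃ c : ℚ, 0 ≤ c ∧ ∀ y : A, σ y = y → f y =
        (c : K) * LinearMap.trace K _ (LinearMap.mulLeft K (p y)))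
      ⟨0, le_rfl, by simp⟩ ?_ ?_ _ (A ⧸ sigmaIdeal σ hmul p) ?_ le_rfl
    · rintro f g ⟨c, hc, h⟩ ⟨c', hc', h'⟩
      refine ⟨c + c', by positivity, fun y hy => ?_⟩
      rw [Pi.add_apply, h y hy, h' y hy]
      push_cast
      ring
    · intro M _ _ _ _ _ _ hM
      exact simple_modTr σ hmul hinvol h1 p hp M hM
    · intro s hs m
      obtain ⟨m, rfl⟩ := Submodule.mkQ_surjective _ m
      rw [← map_smul, ← LinearMap.mem_ker, Submodule.ker_mkQ]
      obtain ⟨h1, h2⟩ := hs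
      exact ⟨by simp [h1], by simp [h2, hmul]⟩
  obtain ⟨c, hc, h⟩ := key
  have hc0 : c ≠ 0 := by
    rintro rfl
    have := h 1 h1
    have hnt : Nontrivial (A ⧸ sigmaIdeal σ hmul p) := by
      refine Submodule.Quotient.nontrivial_iff.2 fun h => ?_
      have : (1 : A) ∈ sigmaIdeal σ hmul p := by rw [h]; trivial
      simpa using this.1
    have hpos : 0 < finrank K (A ⧸ sigmaIdeal σ hmul p) := Module.finrank_pos
    simp only [modTr, map_one, LinearMap.trace_one] at this
    simp only [Rat.cast_zero, zero_mul, Nat.cast_eq_zero] at this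
    omega
  refine ⟨c⁻¹, by positivity, fun y hy => ?_⟩
  have hcK : (c : K) ≠ 0 := by exact_mod_cast hc0
  rw [h y hy, ← mul_assoc]
  push_cast
  rw [inv_mul_cancel₀ hcK, one_mul]

end simple

theorem core {K : Type*} {A : Type v} [Field K] [CharZero K] [Ring A] [Algebra K A]
    [FiniteDimensional K A]
    (σ : A →ₗ[K] A) (hmul : ∀ x y : A, σ (x * y) = σ y * σ x)
    (hinvol : ∀ x, σ (σ x) = x) :
    ∃ (t : ℕ) (I : Fin t → Ideal A), (∀ q, (I q).IsTwoSided) ∧ (∀ q, ∀ x ∈ I q, σ x ∈ I q) ∧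
      (∀ x, x ∈ Ideal.jacobson (⊥ : Ideal A) ↔ ∀ q, x ∈ I q) ∧
      (∀ q r, q ≠ r → ∃ u ∈ I r, 1 - u ∈ I q) ∧ (∀ q, (1 : A) ∉ I q) ∧
      (∀ q (L : Ideal A), (∀ x ∈ L, ∀ a, x * a ∈ L) → (∀ x ∈ L, σ x ∈ L) → ¬ L ≤ I q →
        ∃ u ∈ L, 1 - u ∈ I q) ∧
      ∃ α : Fin t → ℚ, (∀ q, 0 < α q) ∧ ∀ y, σ y = y →
        modTr K A y = ∑ q, (α q : K) * modTr K (A ⧸ I q) y := by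
  classical
  have h1 : σ 1 = 1 := by
    have := hmul 1 (σ 1)
    rw [one_mul, hinvol, one_mul] at this
    exact this.symm
  have : IsArtinianRing A := IsArtinianRing.of_finite K A
  obtain ⟨n, D, d, _, _, _, _, ⟨e⟩⟩ :=
    IsSemisimpleRing.exists_algEquiv_pi_matrix_divisionRing_finite K (A ⧸ Ring.jacobson A)
  let P : A →ₐ[K] ∀ i, Matrix (Fin (d i)) (Fin (d i)) (D i) :=
    e.toAlgHom.comp (Ideal.Quotient.mkₐ K (Ring.jacobson A))
  have hP : Function.Surjective P :=
    e.surjective.comp (Ideal.Quotient.mkₐ_surjective K (Ring.jacobson A))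
  have hJ : ∀ x, P x = 0 ↔ x ∈ Ring.jacobson A := fun x => by
    have : P x = e (Ideal.Quotient.mk (Ring.jacobson A) x) := rfl
    rw [this, map_eq_zero_iff e e.injective, Ideal.Quotient.eq_zero_iff_mem]
  have hnil : ∀ x, P x = 0 → IsNilpotent x := fun x hx => by
    obtain ⟨k, hk⟩ := IsArtinianRing.isNilpotent_jacobson_bot (R := A)
    rw [Ideal.jacobson_bot] at hk
    refine ⟨k, ?_⟩
    have := Ideal.pow_mem_pow ((hJ x).1 hx) k
    rw [hk] at this
    exact this
  let p : ∀ i, A →ₐ[K] Matrix (Fin (d i)) (Fin (d i)) (D i) := fun i =>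
    (Pi.evalAlgHom K _ i).comp P
  have hpP : ∀ i x, p i x = P x i := fun _ _ => rfl
  have hp : ∀ i, Function.Surjective (p i) := fun i =>
    (Function.surjective_eval i).comp hP
  have hσP : ∀ x, P x = 0 → P (σ x) = 0 := by
    have hpow : ∀ (z : A) k, σ (z ^ k) = (σ z) ^ k := fun z k => by
      induction k with
      | zero => simp [h1]
      | succ k ih => rw [pow_succ, hmul, ih, pow_succ']
    let L : Ideal A :=
      { carrier := {x | P (σ x) = 0}
        add_mem' := fun {a b} ha hb => by
          simp only [Set.mem_ofPred_eq] at *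
          simp [ha, hb]
        zero_mem' := by simp
        smul_mem' := fun a b hb => by
          simp only [Set.mem_ofPred_eq] at *
          simp [hmul, hb] }
    intro x hx
    have hxL : σ x ∈ L := by
      change P (σ (σ x)) = 0
      rw [hinvol, hx]
    funext i
    by_contra hne
    obtain ⟨u, hu, hu1⟩ := exists_unit_preimage (p i).toRingHom (hp i) L (fun x hx a => by
      have hx : P (σ x) = 0 := hx
      change P (σ (x * a)) = 0
      simp [hmul, hx]) (σ x) hxL hne
    obtain ⟨k, hk⟩ := hnil (σ u) hu
    have hk' : u ^ k = 0 := by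
      have := congrArg σ hk
      rwa [hpow, hinvol, map_zero] at this
    have := congrArg (p i).toRingHom hk'
    rw [map_pow, hu1, one_pow, map_zero] at this
    exact one_ne_zero this
  -- the ideals
  let I0 : Fin n → Ideal A := fun i => sigmaIdeal σ hmul (p i)
  have hmem : ∀ i x, x ∈ I0 i ↔ p i x = 0 ∧ p i (σ x) = 0 := fun _ _ => Iff.rfl
  obtain ⟨t, I, hIinj, hI1, hI2⟩ : ∃ (t : ℕ) (I : Fin t → Ideal A), Function.Injective I ∧
      (∀ q, ∃ i, I q = I0 i) ∧ (∀ i, ∃ q, I q = I0 i) := by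
    have : Finite (Set.range I0) := Set.finite_range I0
    let eq := Finite.equivFin (Set.range I0)
    refine ⟨_, fun q => (eq.symm q : Ideal A), fun a b h => eq.symm.injective (Subtype.ext h),
      fun q => ?_, fun i => ⟨eq ⟨I0 i, i, rfl⟩, ?_⟩⟩
    · obtain ⟨i, hi⟩ := (eq.symm q).2
      exact ⟨i, hi.symm⟩
    · change ((eq.symm (eq ⟨I0 i, i, rfl⟩) : Set.range I0) : Ideal A) = _
      rw [Equiv.symm_apply_apply]
  have hts : ∀ q, (I q).IsTwoSided := fun q => by
    obtain ⟨i, hi⟩ := hI1 q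
    rw [hi]
    refine ⟨fun {a} b ha => ?_⟩
    rw [hmem] at ha ⊢
    simp [ha.1, ha.2, hmul]
  have hst : ∀ q, ∀ x ∈ I q, σ x ∈ I q := fun q x => by
    obtain ⟨i, hi⟩ := hI1 q
    rw [hi, hmem, hmem, hinvol]
    exact fun h => ⟨h.2, h.1⟩
  have hmax : ∀ q (L : Ideal A), (∀ x ∈ L, ∀ a, x * a ∈ L) → (∀ x ∈ L, σ x ∈ L) → ¬ L ≤ I q →
        ∃ u ∈ L, 1 - u ∈ I q := by
    intro q L hL1 hL2 hL3
    obtain ⟨i, hi⟩ := hI1 q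
    rw [hi] at hL3 ⊢
    obtain ⟨x, hx, hx'⟩ := Set.not_subset.1 hL3
    have : ∃ x ∈ L, p i x ≠ 0 := by
      by_contra hcon
      push Not at hcon
      exact hx' ⟨hcon x hx, hcon _ (hL2 x hx)⟩
    obtain ⟨z, hz, hz'⟩ := this
    obtain ⟨u, hu, hu1⟩ := exists_unit_preimage (p i).toRingHom (hp i) L hL1 z hz hz'
    have hu1 : p i u = 1 := hu1
    have e1 : 1 - (u + σ u - u * σ u) = (1 - u) * (1 - σ u) := by noncomm_ring
    refine ⟨u + σ u - u * σ u, L.sub_mem (L.add_mem hu (hL2 u hu)) (hL1 u hu _), ?_⟩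
    rw [e1, hmem]
    constructor
    · simp [hu1]
    · rw [hmul, map_sub, map_sub, hinvol, h1, map_mul]
      simp [hu1]
  have hJI : ∀ x, x ∈ Ideal.jacobson (⊥ : Ideal A) ↔ ∀ q, x ∈ I q := by
    intro x
    rw [Ideal.jacobson_bot, ← hJ]
    constructor
    · intro hx q
      obtain ⟨i, hi⟩ := hI1 q
      rw [hi, hmem, hpP, hpP, hx, hσP x hx]
      exact ⟨rfl, rfl⟩
    · intro h
      funext i
      obtain ⟨q, hq⟩ := hI2 i
      have := h q
      rw [hq] at this
      exact this.1
  have hcop : ∀ q r, q ≠ r → ∃ u ∈ I r, 1 - u ∈ I q := by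
    intro q r hqr
    have hne : I q ≠ I r := fun h => hqr (hIinj h)
    have hcl : ∀ s, ∀ x ∈ I s, ∀ a, x * a ∈ I s := fun s x hx a => (hts s).mul_mem_of_left a hx
    by_cases hle : I r ≤ I q
    · have hle' : ¬ I q ≤ I r := fun h => hne (le_antisymm h hle)
      obtain ⟨u, hu, hu'⟩ := hmax r (I q) (hcl q) (hst q) hle'
      exact ⟨1 - u, hu', by simpa using hu⟩
    · exact hmax q (I r) (hcl r) (hst r) hle
  have hone : ∀ q, (1 : A) ∉ I q := by
    intro q hq
    obtain ⟨i, hi⟩ := hI1 q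
    rw [hi] at hq
    have := hq.1
    rw [map_one] at this
    exact one_ne_zero this
  refine ⟨t, I, hts, hst, hJI, hcop, hone, hmax, ?_⟩
  -- the trace statement for all modules
  have M2 : ∀ (M : Type v) [AddCommGroup M] [Module K M] [Module A M] [IsScalarTower K A M]
      [FiniteDimensional K M], ∃ β : Fin t → ℚ, (∀ q, 0 ≤ β q) ∧
      ∀ y, σ y = y → modTr K M y = ∑ q, (β q : K) * modTr K (A ⧸ I q) y := by
    intro M _ _ _ _ _
    refine mod_induction (∅ : Set A)
      (fun f => ∃ β : Fin t → ℚ, (∀ q, 0 ≤ β q) ∧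
      ∀ y, σ y = y → f y = ∑ q, (β q : K) * modTr K (A ⧸ I q) y)
      ⟨0, fun _ => le_rfl, by simp⟩ ?_ ?_ _ M (by simp) le_rfl
    · rintro f g ⟨c, hc, h⟩ ⟨c', hc', h'⟩
      refine ⟨c + c', fun q => add_nonneg (hc q) (hc' q), fun y hy => ?_⟩
      rw [Pi.add_apply, h y hy, h' y hy, ← Finset.sum_add_distrib]
      refine Finset.sum_congr rfl fun q _ => ?_
      rw [Pi.add_apply]
      push_cast
      ring
    · intro M _ _ _ _ _ _ _
      have hann : ∀ a, P a = 0 → ∀ m : M, a • m = 0 := fun a ha m =>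
        Module.mem_annihilator.1 (IsSemisimpleModule.jacobson_le_annihilator A M ((hJ a).1 ha)) m
      have : ∃ i, ∀ a, p i a = 0 → ∀ m : M, a • m = 0 := by
        choose ε hε using fun i : Fin n => hP (Pi.single i 1)
        have hsum : ∀ m : M, ∑ i, ε i • m = m := fun m => by
          have := hann (1 - ∑ i, ε i) (by
            rw [map_sub, map_one, map_sum]
            simp only [hε]
            rw [sub_eq_zero]
            exact (Finset.univ_sum_single (1 : ∀ i, Matrix (Fin (d i)) (Fin (d i)) (D i))).symm) m
          rw [sub_smul, one_smul, sub_eq_zero, Finset.sum_smul] at this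
          exact this.symm
        have hnt : Nontrivial M := IsSimpleModule.nontrivial A M
        obtain ⟨m, hm⟩ := exists_ne (0 : M)
        have : ∃ i, ε i • m ≠ 0 := by
          by_contra hcon
          push Not at hcon
          apply hm
          rw [← hsum m]
          exact Finset.sum_eq_zero fun i _ => hcon i
        obtain ⟨i, hi⟩ := this
        refine ⟨i, ?_⟩
        let N : Submodule A M :=
          { carrier := {m | ∀ b, p i b = 0 → b • m = 0}
            add_mem' := fun {x y} hx hy b hb => by rw [smul_add, hx b hb, hy b hb, add_zero]
            zero_mem' := fun b hb => smul_zero _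
            smul_mem' := fun c x hx b hb => by
              have := hx (b * c) (by simp [hb])
              rwa [mul_smul] at this }
        have hmemN : ε i • m ∈ N := fun b hb => by
          rw [← mul_smul]
          apply hann
          rw [map_mul, hε]
          funext j
          by_cases hj : j = i
          · subst hj
            rw [Pi.mul_apply, ← hpP, hb, zero_mul]
            rfl
          · rw [Pi.mul_apply, Pi.single_eq_of_ne hj, mul_zero]
            rfl
        have hN : N = ⊤ := by
          rcases eq_bot_or_eq_top N with h | h
          · rw [h] at hmemN; exact absurd hmemN hi
          · exact h
        intro b hb m
        have : m ∈ N := by rw [hN]; trivial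
        exact this b hb
      obtain ⟨i, hi⟩ := this
      obtain ⟨c, hc, hcy⟩ := modTr_of_ker (p i) (hp i) M hi
      obtain ⟨c', hc', hcy'⟩ := sigma_quot_modTr σ hmul hinvol h1 (p i) (hp i)
      obtain ⟨q, hq⟩ := hI2 i
      change I q = sigmaIdeal σ hmul (p i) at hq
      rw [← hq] at hcy'
      refine ⟨Pi.single q (c * c'), ?_, fun y hy => ?_⟩
      · intro r
        by_cases hr : r = q
        · subst hr; simp only [Pi.single_eq_same]; positivity
        · rw [Pi.single_eq_of_ne hr]
      · rw [hcy, hcy' y hy, Finset.sum_eq_single q]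
        · rw [Pi.single_eq_same]; push_cast; ring
        · intro r _ hr
          rw [Pi.single_eq_of_ne hr]; simp
        · simp
  choose β hβ hβy using fun q => M2 (I q)
  by_cases ht : t = 0
  · obtain ⟨γ, _, hγ⟩ := M2 A
    refine ⟨γ, fun q => ?_, hγ⟩
    exact absurd q.2 (by omega)
  have ht' : (t : K) ≠ 0 := by exact_mod_cast ht
  have htQ : (0 : ℚ) < (t : ℚ) := by
    exact_mod_cast Nat.pos_of_ne_zero ht
  refine ⟨fun q => (1 + ∑ r, β r q) / (t : ℚ), fun q => ?_, fun y hy => ?_⟩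
  · have : 0 ≤ ∑ r, β r q := Finset.sum_nonneg fun r _ => hβ r q
    positivity
  · have hA : ∀ r, modTr K A y = (∑ q, (β r q : K) * modTr K (A ⧸ I q) y) +
        modTr K (A ⧸ I r) y := fun r => by
      rw [← hβy r y hy, modTr_exact A (I r)]
      rfl
    have hsum : (t : K) * modTr K A y =
        ∑ r, ((∑ q, (β r q : K) * modTr K (A ⧸ I q) y) + modTr K (A ⧸ I r) y) := by
      rw [← Finset.sum_congr rfl (fun r _ => hA r)]
      simp
    rw [Finset.sum_add_distrib, Finset.sum_comm, ← Finset.sum_add_distrib] at hsum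
    apply mul_left_cancel₀ ht'
    rw [hsum, Finset.mul_sum]
    refine Finset.sum_congr rfl fun q _ => ?_
    push_cast
    rw [← Finset.sum_mul]
    field_simp
    ring

theorem crt_aux {A : Type*} [Ring A] {t : ℕ} (I : Fin t → Ideal A) (hts : ∀ q, (I q).IsTwoSided)
    (hcop : ∀ q r, q ≠ r → ∃ u ∈ I r, 1 - u ∈ I q) (q : Fin t) (S : Finset (Fin t)) :
    q ∉ S → ∃ e : A, 1 - e ∈ I q ∧ ∀ r ∈ S, e ∈ I r := by
  classical
  induction S using Finset.induction_on with
  | empty => exact fun _ => ⟨1, by simp, by simp⟩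
  | insert s S hs ih =>
    intro hq
    rw [Finset.mem_insert, not_or] at hq
    obtain ⟨e, he, he'⟩ := ih hq.2
    obtain ⟨u, hu, hu'⟩ := hcop q s hq.1
    refine ⟨e * u, ?_, fun r hr => ?_⟩
    · have : 1 - e * u = (1 - e) + e * (1 - u) := by noncomm_ring
      rw [this]
      exact (I q).add_mem he ((I q).mul_mem_left _ hu')
    · rcases Finset.mem_insert.1 hr with rfl | hr
      · exact Ideal.mul_mem_left _ _ hu
      · exact (hts r).mul_mem_of_left _ (he' r hr)

end helpers

/-- **Lemma.** In characteristic `0`, the semisimple quotient `A/J` of an algebra with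
involution `(A,σ)` factors as a product of simple algebras with involution
`(A₁,σ₁), …, (A_t,σ_t)`, and `q_{A,σ} ≅ α₁ q_{A₁,σ₁} ⊕ ⋯ ⊕ α_t q_{A_t,σ_t} ⊕ ⟨0,…,0⟩`
for some positive rationals `α₁, …, α_t`. -/
theorem statement9 {K : Type*} {A : Type v} [Field K] [CharZero K]
    [Ring A] [Algebra K A] [FiniteDimensional K A]
    (σ : A → A)
    (hadd : ∀ x y : A, σ (x + y) = σ x + σ y)
    (hsmul : ∀ (c : K) (x : A), σ (c • x) = c • σ x)
    (hmul : ∀ x y : A, σ (x * y) = σ y * σ x)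
    (hinvol : ∀ x : A, σ (σ x) = x) :
    ∃ (t : ℕ) (A' : Fin t → Type v)
      (_ : ∀ i, Ring (A' i)) (_ : ∀ i, Algebra K (A' i))
      (_ : ∀ i, FiniteDimensional K (A' i))
      (σ' : ∀ i, A' i → A' i) (π : A →ₐ[K] ∀ i, A' i),
      -- `π` identifies `∏ᵢ A'ᵢ` with the quotient of `A` by its Jacobson radical
      Function.Surjective π ∧
      RingHom.ker π.toRingHom = Ideal.jacobson (⊥ : Ideal A) ∧
      -- the involution induced by `σ` on the quotient is `∏ᵢ σ'ᵢ`
      (∀ x : A, π (σ x) = fun i => σ' i (π x i)) ∧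
      -- each `(A'ᵢ, σ'ᵢ)` is a simple `K`-algebra with involution
      (∀ i, (∀ x y : A' i, σ' i (x + y) = σ' i x + σ' i y) ∧
        (∀ (c : K) (x : A' i), σ' i (c • x) = c • σ' i x) ∧
        (∀ x y : A' i, σ' i (x * y) = σ' i y * σ' i x) ∧
        (∀ x : A' i, σ' i (σ' i x) = x) ∧
        Nontrivial (A' i) ∧
        (∀ I : Submodule K (A' i), (∀ a : A' i, ∀ x ∈ I, a * x ∈ I) →
          (∀ a : A' i, ∀ x ∈ I, x * a ∈ I) → (∀ x ∈ I, σ' i x ∈ I) →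
          I = ⊥ ∨ I = ⊤)) ∧
      -- the isometry `q_{A,σ} ≅ α₁ q_{A₁,σ₁} ⊕ ⋯ ⊕ α_t q_{A_t,σ_t} ⊕ ⟨0,…,0⟩`
      ∃ (α : Fin t → ℚ) (m : ℕ) (e : A ≃ₗ[K] ((∀ i, A' i) × (Fin m → K))),
        (∀ i, 0 < α i) ∧
        ∀ x : A, involutionTraceForm K σ x =
          ∑ i, (α i : K) * involutionTraceForm K (σ' i) ((e x).1 i) := by
  classical
  obtain ⟨t, I, hts, hst, hJI, hcop, hone, hmax, α, hα, htr⟩ :=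
    core (⟨⟨σ, hadd⟩, hsmul⟩ : A →ₗ[K] A) hmul hinvol
  replace hst : ∀ q, ∀ x ∈ I q, σ x ∈ I q := hst
  have hsub : ∀ x y, σ (x - y) = σ x - σ y := map_sub (⟨⟨σ, hadd⟩, hsmul⟩ : A →ₗ[K] A)
  let mk : ∀ q, A →ₐ[K] A ⧸ I q := fun q => Ideal.Quotient.mkₐ K (I q)
  have hmk : ∀ q, Function.Surjective (mk q) := fun q => Ideal.Quotient.mkₐ_surjective K (I q)
  have hmk0 : ∀ q x, mk q x = 0 ↔ x ∈ I q := fun q x => Ideal.Quotient.eq_zero_iff_mem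
  obtain ⟨σ', hσ'⟩ : ∃ σ' : ∀ q, A ⧸ I q → A ⧸ I q, ∀ q x, σ' q (mk q x) = mk q (σ x) := by
    refine ⟨fun q z => mk q (σ (Function.surjInv (hmk q) z)), fun q x => ?_⟩
    rw [← sub_eq_zero, ← map_sub, ← hsub, hmk0]
    apply hst
    rw [← hmk0, map_sub, Function.surjInv_eq (hmk q), sub_self]
  let π : A →ₐ[K] ∀ q, A ⧸ I q := AlgHom.pi mk
  have hπ : ∀ x q, π x q = mk q x := fun _ _ => rfl
  have hπs : Function.Surjective π := by
    choose e he he' using fun q => crt_aux I hts hcop q (Finset.univ.erase q) (by simp)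
    intro f
    choose g hg using fun q => hmk q (f q)
    refine ⟨∑ q, g q * e q, ?_⟩
    funext q
    rw [hπ, map_sum, Finset.sum_eq_single q]
    · have := (hmk0 q _).2 (he q)
      rw [map_sub, sub_eq_zero, map_one] at this
      rw [map_mul, ← this, mul_one, hg]
    · intro r _ hr
      rw [hmk0]
      exact Ideal.mul_mem_left _ _ (he' r q (by simp [hr.symm]))
    · simp
  have hfd : ∀ q, FiniteDimensional K (A ⧸ I q) := fun q =>
    Module.Finite.of_surjective (mk q).toLinearMap (hmk q)
  refine ⟨t, fun q => A ⧸ I q, fun q => inferInstance, fun q => inferInstance, hfd, σ', π, hπs,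
    ?_, ?_, ?_, α, finrank K (LinearMap.ker π.toLinearMap), ?_⟩
  · ext x
    rw [hJI, RingHom.mem_ker]
    change π x = 0 ↔ _
    rw [funext_iff]
    exact forall_congr' fun q => hmk0 q x
  · intro x
    funext q
    rw [hπ, hπ, hσ']
  · intro q
    refine ⟨?_, ?_, ?_, ?_, ?_, ?_⟩
    · intro x y
      obtain ⟨x, rfl⟩ := hmk q x
      obtain ⟨y, rfl⟩ := hmk q y
      rw [← map_add, hσ', hσ', hσ', hadd, map_add]
    · intro c x
      obtain ⟨x, rfl⟩ := hmk q x
      rw [← map_smul, hσ', hσ', hsmul, map_smul]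
    · intro x y
      obtain ⟨x, rfl⟩ := hmk q x
      obtain ⟨y, rfl⟩ := hmk q y
      rw [← map_mul, hσ', hσ', hσ', hmul, map_mul]
    · intro x
      obtain ⟨x, rfl⟩ := hmk q x
      rw [hσ', hσ', hinvol]
    · refine ⟨⟨mk q 1, 0, fun h => hone q ((hmk0 q 1).1 h)⟩⟩
    · intro N hl hr hs
      let L : Ideal A :=
        { carrier := {x | mk q x ∈ N}
          add_mem' := fun {a b} ha hb => by
            change mk q (a + b) ∈ N
            rw [map_add]
            exact N.add_mem ha hb
          zero_mem' := by
            change mk q 0 ∈ N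
            rw [map_zero]
            exact N.zero_mem
          smul_mem' := fun a b hb => by
            change mk q (a * b) ∈ N
            rw [map_mul]
            exact hl _ _ hb }
      have hL : ∀ x, x ∈ L ↔ mk q x ∈ N := fun _ => Iff.rfl
      by_cases hle : L ≤ I q
      · left
        rw [eq_bot_iff]
        intro z hz
        obtain ⟨x, rfl⟩ := hmk q z
        exact (hmk0 q x).2 (hle hz)
      · right
        obtain ⟨u, hu, hu'⟩ := hmax q L (fun x hx a => by
          rw [hL, map_mul]
          exact hr _ _ hx) (fun x hx => by
          change mk q (σ x) ∈ N
          rw [← hσ']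
          exact hs _ hx) hle
        rw [← hmk0, map_sub, sub_eq_zero, map_one] at hu'
        rw [hL, ← hu'] at hu
        rw [eq_top_iff]
        intro z _
        have := hl z _ hu
        rwa [mul_one] at this
  · let πl : A →ₗ[K] ∀ q, A ⧸ I q := π.toLinearMap
    obtain ⟨pr, hpr⟩ := (LinearMap.ker πl).subtype.exists_leftInverse_of_injective
      (LinearMap.ker_eq_bot.2 (LinearMap.ker πl).subtype_injective)
    have hpr' : ∀ k : LinearMap.ker πl, pr k = k := fun k => LinearMap.congr_fun hpr k
    have hbij : Function.Bijective (πl.prod pr) := by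
      constructor
      · rw [← LinearMap.ker_eq_bot, eq_bot_iff]
        intro x hx
        rw [LinearMap.mem_ker, LinearMap.prod_apply, Function.prod_apply, Prod.mk_eq_zero] at hx
        have h2 : pr x = ⟨x, hx.1⟩ := hpr' ⟨x, hx.1⟩
        exact congrArg Subtype.val (h2.symm.trans hx.2)
      · rintro ⟨f, k⟩
        obtain ⟨x, hx⟩ := hπs f
        refine ⟨x - (pr x : A) + (k : A), Prod.ext ?_ ?_⟩
        · change πl _ = f
          rw [map_add, map_sub, (pr x).2, k.2, sub_zero, add_zero]
          exact hx
        · change pr _ = k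
          rw [map_add, map_sub, hpr', hpr', sub_self, zero_add]
    let e0 := LinearEquiv.ofBijective _ hbij
    refine ⟨e0.trans (LinearEquiv.prodCongr (LinearEquiv.refl K _)
      (finBasis K (LinearMap.ker πl)).equivFun), hα, fun x => ?_⟩
    have h := htr (σ x * x) (by
      change σ (σ x * x) = _
      rw [hmul, hinvol])
    refine Eq.trans h (Finset.sum_congr rfl fun q _ => ?_)
    congr 1
    change _ = LinearMap.trace K (A ⧸ I q) (LinearMap.mulLeft K (σ' q (mk q x) * mk q x))
    rw [hσ', ← map_mul]
    unfold modTr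
    congr 1
end

section
/- Let K be a field of characteristic ≠ 2, let (A, σ) be a finite-dimensional K-algebra with involution, and let L/K be a finite field extension of odd degree. Then (A_L, σ_L) = (A ⊗_K L, σ ⊗ id_L) is hyperbolic if and only if (A, σ) is hyperbolic. -/
open Module TensorProduct

/-- A ring with involution is hyperbolic if it contains an idempotent `e` with
`e^σ + e = 1`. -/
def InvolutionHyperbolic {B : Type*} [Ring B] (τ : B → B) : Prop :=
  ∃ e : B, e * e = e ∧ τ e + e = 1

/-- transport of hyperbolicity along a ring homomorphism compatible with the involutions -/
theorem hyp_transport {B C : Type*} [Ring B] [Ring C] (τ : B → B) (τ' : C → C) (f : B →+* C)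
    (hf : ∀ x, f (τ x) = τ' (f x)) (h : InvolutionHyperbolic τ) : InvolutionHyperbolic τ' := by
  obtain ⟨e, he, h1⟩ := h
  refine ⟨f e, by rw [← map_mul, he], ?_⟩
  rw [← hf, ← map_add, h1, map_one]

section Core

set_option linter.unusedSectionVars false

variable {A B : Type*} [Ring A] [Ring B] [Module A B] [IsScalarTower A B B]

/-- the span of the first `k` powers -/
def WW (A : Type*) {B : Type*} [Ring A] [Ring B] [Module A B] (α : B) (k : ℕ) : Submodule A B :=
  Submodule.span A {x | ∃ i < k, x = α ^ i}

theorem WW_pow (α : B) {i k : ℕ} (h : i < k) : α ^ i ∈ WW A α k :=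
  Submodule.subset_span ⟨i, h, rfl⟩

theorem WW_zero (α : B) : WW A α 0 = ⊥ := by
  simp [WW]

theorem WW_succ (α : B) (k : ℕ) (x : B) (hx : x ∈ WW A α (k + 1)) :
    ∃ a : A, x - a • α ^ k ∈ WW A α k := by
  induction hx using Submodule.span_induction with
  | mem x h =>
    obtain ⟨i, hi, rfl⟩ := h
    rcases Nat.lt_succ_iff_lt_or_eq.1 hi with h | rfl
    · exact ⟨0, by simpa using WW_pow α h⟩
    · exact ⟨1, by simp⟩
  | zero => exact ⟨0, by simp⟩
  | add x y _ _ h1 h2 =>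
    obtain ⟨a, ha⟩ := h1
    obtain ⟨b, hb⟩ := h2
    refine ⟨a + b, ?_⟩
    have := add_mem ha hb
    rw [add_smul]
    convert this using 1
    abel
  | smul c x _ h =>
    obtain ⟨a, ha⟩ := h
    refine ⟨c * a, ?_⟩
    have := Submodule.smul_mem _ c ha
    rwa [smul_sub, smul_smul] at this

theorem WW_mul (α : B) (hα : ∀ (i : ℕ) (x : B) (a : A), α ^ i * (a • x) = a • (α ^ i * x))
    (n : ℕ) (S : B →ₗ[A] A) (hS : ∀ i, i + 1 < n → S (α ^ i) = 0)
    (k l : ℕ) (hkl : k + l ≤ n) (x y : B) (hx : x ∈ WW A α k) (hy : y ∈ WW A α l) :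
    S (x * y) = 0 := by
  induction hx using Submodule.span_induction with
  | zero => simp
  | add x y _ _ h1 h2 => simp [add_mul, h1, h2]
  | smul c x _ h => simp only [smul_mul_assoc, map_smul, h, smul_zero]
  | mem x h =>
    obtain ⟨i, hi, rfl⟩ := h
    induction hy using Submodule.span_induction with
    | zero => simp
    | add x y _ _ h1 h2 => simp [mul_add, h1, h2]
    | smul c x _ h => simp [hα, h]
    | mem y h =>
      obtain ⟨j, hj, rfl⟩ := h
      rw [← pow_add]
      exact hS _ (by omega)

theorem WW_perp (α : B) (hα : ∀ (i : ℕ) (x : B) (a : A), α ^ i * (a • x) = a • (α ^ i * x))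
    (n : ℕ) (S : B →ₗ[A] A) (hS : ∀ i, i + 1 < n → S (α ^ i) = 0)
    (hS1 : ∀ i, i + 1 = n → S (α ^ i) = 1) (htop : WW A α n = ⊤)
    (k : ℕ) (hk : k ≤ n) (x : B) (hx : ∀ i < k, S (α ^ i * x) = 0) : x ∈ WW A α (n - k) := by
  induction k with
  | zero => simp [htop]
  | succ k ih =>
    have h1 := ih (by omega) (fun i hi => hx i (by omega))
    obtain ⟨l, rfl⟩ : ∃ l, n = k + 1 + l := ⟨n - (k+1), by omega⟩
    have e1 : k + 1 + l - k = l + 1 := by omega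
    have e2 : k + 1 + l - (k + 1) = l := by omega
    rw [e1] at h1
    rw [e2]
    obtain ⟨a, ha⟩ := WW_succ α l x h1
    have h2 := WW_mul α hα _ S hS (k+1) l le_rfl (α ^ k) _ (WW_pow α (by omega)) ha
    rw [mul_sub, map_sub, hx k (by omega), hα, map_smul, ← pow_add, hS1 _ (by omega)] at h2
    have : a = 0 := by simpa using h2
    simpa [this] using ha

theorem WW_rep (α : B) (hα : ∀ (i : ℕ) (x : B) (a : A), α ^ i * (a • x) = a • (α ^ i * x))
    (n : ℕ) (S : B →ₗ[A] A) (hS : ∀ i, i + 1 < n → S (α ^ i) = 0)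
    (hS1 : ∀ i, i + 1 = n → S (α ^ i) = 1) (htop : WW A α n = ⊤) (φ : B →ₗ[A] A) :
    ∃ w, ∀ y, φ y = S (y * w) := by
  have key : ∀ k ≤ n, ∃ w, ∀ i < k, φ (α ^ i) = S (α ^ i * w) := by
    intro k hk
    induction k with
    | zero => exact ⟨0, by simp⟩
    | succ k ih =>
      obtain ⟨w, hw⟩ := ih (by omega)
      refine ⟨w + (φ (α ^ k) - S (α ^ k * w)) • α ^ (n - 1 - k), fun i hi => ?_⟩
      rw [mul_add, hα, map_add, map_smul, ← pow_add]
      rcases Nat.lt_succ_iff_lt_or_eq.1 hi with h | rfl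
      · rw [hS _ (by omega), hw i h]; simp
      · rw [hS1 _ (by omega)]; simp
  obtain ⟨w, hw⟩ := key n le_rfl
  refine ⟨w, fun y => ?_⟩
  have hy : y ∈ WW A α n := by rw [htop]; trivial
  induction hy using Submodule.span_induction with
  | zero => simp
  | add x y _ _ h1 h2 => simp [add_mul, h1, h2]
  | smul c x _ h => simp only [smul_mul_assoc, map_smul, h, smul_zero]
  | mem x h =>
    obtain ⟨i, hi, rfl⟩ := h
    exact hw i hi

theorem core_ideal [IsSemisimpleRing A] (σ : A →+ A) (τ : B →+ B)
    (hτmul : ∀ x y, τ (x * y) = τ y * τ x) (hτ : ∀ x, τ (τ x) = x)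
    (α : B) (hα : ∀ (i : ℕ) (x : B) (a : A), α ^ i * (a • x) = a • (α ^ i * x))
    (hcomm : ∀ (i : ℕ) (x : B), α ^ i * x = x * α ^ i)
    (hτσ : ∀ (a : A) i, τ (a • α ^ i) = σ a • α ^ i)
    (m : ℕ) (S : B →ₗ[A] A) (hS : ∀ i, i + 1 < 2 * m + 1 → S (α ^ i) = 0)
    (hS1 : ∀ i, i + 1 = 2 * m + 1 → S (α ^ i) = 1) (htop : WW A α (2 * m + 1) = ⊤)
    (h : InvolutionHyperbolic τ) :
    ∃ I : Ideal A, (∀ a ∈ I, ∀ b ∈ I, a * σ b = 0) ∧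
      ∀ c, (∀ a ∈ I, c * σ a = 0) → c ∈ I := by
  obtain ⟨e, he, h1⟩ := h
  have hte : τ e = 1 - e := by rw [← h1]; abel
  have hete : e * τ e = 0 := by rw [hte, mul_sub, he]; simp
  let N : Submodule A B :=
    { carrier := {x | x * e = x}
      add_mem' := by intro a b ha hb; change (a + b) * e = a + b; rw [add_mul, show a * e = a from ha, show b * e = b from hb]
      zero_mem' := by simp
      smul_mem' := by intro c x hx; change (c • x) * e = c • x; rw [smul_mul_assoc, show x * e = x from hx] }
  have hN : ∀ x, x ∈ N ↔ x * e = x := fun x => Iff.rfl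
  have hNN : ∀ x ∈ N, ∀ y ∈ N, x * τ y = 0 := by
    intro x hx y hy
    rw [← (hN x).1 hx, ← (hN y).1 hy, hτmul, mul_assoc, ← mul_assoc e, hete]; simp
  have hτW : ∀ k, ∀ x ∈ WW A α k, τ x ∈ WW A α k := by
    intro k
    induction k with
    | zero => intro x hx; rw [WW_zero, Submodule.mem_bot] at hx; simp [hx]
    | succ k ih =>
      intro x hx
      obtain ⟨a, ha⟩ := WW_succ α k x hx
      have h2 := ih _ ha
      rw [map_sub, hτσ] at h2
      have h3 : WW A α k ≤ WW A α (k+1) := Submodule.span_mono (by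
        rintro _ ⟨i, hi, rfl⟩; exact ⟨i, by omega, rfl⟩)
      have h4 := add_mem (h3 h2) (Submodule.smul_mem _ (σ a) (WW_pow (A := A) α (Nat.lt_succ_self k)))
      simpa using h4
  have hWle : WW A α m ≤ WW A α (m+1) := Submodule.span_mono (by
        rintro _ ⟨i, hi, rfl⟩; exact ⟨i, by omega, rfl⟩)
  have hmem : ∀ (a : A) (x : B), x - a • α ^ m ∈ WW A α m → x ∈ WW A α (m+1) := by
    intro a x hx
    have h4 := add_mem (hWle hx) (Submodule.smul_mem _ a (WW_pow (A := A) α (Nat.lt_succ_self m)))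
    simpa using h4
  -- the pairing of "leading coefficients"
  have pair : ∀ (a b : A) (x y : B), x - a • α ^ m ∈ WW A α m → y - b • α ^ m ∈ WW A α m →
      S (x * τ y) = a * σ b := by
    intro a b x y hx hy
    have e1 := WW_mul α hα _ S hS m (m+1) (by omega) _ _ hx (hτW _ _ (hmem b y hy))
    have e2 := WW_mul α hα _ S hS (m+1) m (by omega) _ _
      (Submodule.smul_mem _ a (WW_pow (A := A) α (Nat.lt_succ_self m))) (hτW _ _ hy)
    rw [map_sub, hτσ, mul_sub, map_sub, smul_mul_assoc a _ (σ b • α ^ m), hα, ← pow_add, map_smul,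
      map_smul, hS1 _ (by omega), sub_eq_zero] at e2
    rw [sub_mul, map_sub, sub_eq_zero] at e1
    rw [e1, e2]; simp
  let I : Ideal A :=
    { carrier := {a | ∃ x ∈ N, x - a • α ^ m ∈ WW A α m}
      add_mem' := by
        rintro a b ⟨x, hx, hx'⟩ ⟨y, hy, hy'⟩
        refine ⟨x + y, add_mem hx hy, ?_⟩
        have := add_mem hx' hy'
        rw [add_smul]
        convert this using 1
        abel
      zero_mem' := ⟨0, by simp, by simp⟩
      smul_mem' := by
        rintro c a ⟨x, hx, hx'⟩
        refine ⟨c • x, Submodule.smul_mem _ _ hx, ?_⟩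
        have := Submodule.smul_mem _ c hx'
        rwa [smul_sub, smul_smul] at this }
  refine ⟨I, ?_, ?_⟩
  · rintro a ⟨x, hx, hx'⟩ b ⟨y, hy, hy'⟩
    rw [← pair a b x y hx' hy', hNN x hx y hy, map_zero]
  · intro c hc
    by_contra hcI
    have hX : c • α ^ m ∉ N ⊔ WW A α m := by
      intro hX
      obtain ⟨x, hx, y, hy, hxy⟩ := Submodule.mem_sup.1 hX
      refine hcI ⟨x, hx, ?_⟩
      rw [← hxy]
      simpa using hy
    obtain ⟨Y, hY⟩ := exists_isCompl (N ⊔ WW A α m)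
    let π : B →ₗ[A] B := Y.projectionOnto _ hY.symm |> (Y.subtype.comp ·)
    have hπ : π (c • α ^ m) ≠ 0 := by
      intro h0
      apply hX
      have : (Y.projectionOnto _ hY.symm) (c • α ^ m) = 0 := Subtype.ext h0
      exact (Submodule.projectionOnto_apply_eq_zero_iff hY.symm).1 this
    have hπ0 : ∀ x ∈ N ⊔ WW A α m, π x = 0 := by
      intro x hx
      have : (Y.projectionOnto _ hY.symm) x = 0 := by simpa using hx
      simp [π, this]
    obtain ⟨i, hi⟩ : ∃ i, S (α ^ i * π (c • α ^ m)) ≠ 0 := by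
      by_contra! hcon
      have := WW_perp α hα _ S hS hS1 htop _ le_rfl _ (fun i _ => hcon i)
      rw [Nat.sub_self, WW_zero] at this
      exact hπ this
    let φ : B →ₗ[A] A :=
      { toFun := fun y => S (π y * α ^ i)
        map_add' := by intro x y; rw [map_add, add_mul, map_add]
        map_smul' := by intro a x; rw [map_smul, smul_mul_assoc, map_smul]; rfl }
    have hφ : ∀ y, φ y = S (π y * α ^ i) := fun y => rfl
    obtain ⟨w, hw⟩ := WW_rep α hα _ S hS hS1 htop φ
    have hw0 : ∀ x ∈ N ⊔ WW A α m, S (x * w) = 0 := by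
      intro x hx
      rw [← hw, hφ, hπ0 x hx]; simp
    have hwc : S ((c • α ^ m) * w) ≠ 0 := by
      rw [← hw, hφ, ← hcomm]; exact hi
    have hew : e * w = 0 := by
      have := WW_perp α hα _ S hS hS1 htop _ le_rfl (e * w) (fun i _ => by
        rw [← mul_assoc]
        refine hw0 _ (Submodule.mem_sup_left ?_)
        rw [hN, mul_assoc, he])
      rwa [Nat.sub_self, WW_zero] at this
    have hwN : τ w ∈ N := by
      rw [hN]
      have : τ w * τ e = 0 := by rw [← hτmul, hew, map_zero]
      rw [hte, mul_sub, mul_one, sub_eq_zero] at this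
      exact this.symm
    have hwW : w ∈ WW A α (m+1) := by
      have := WW_perp α hα _ S hS hS1 htop m (by omega) w (fun i hi =>
        hw0 _ (Submodule.mem_sup_right (WW_pow α hi)))
      rwa [show 2 * m + 1 - m = m + 1 by omega] at this
    obtain ⟨a, ha⟩ := WW_succ α m _ (hτW _ _ hwW)
    apply hwc
    have := pair c a (c • α ^ m) (τ w) (by simp) ha
    rw [hτ] at this
    rw [this]
    exact hc a ⟨τ w, hwN, ha⟩

end Core

theorem core_semisimple {K A : Type*} [Field K] (hchar : (2 : K) ≠ 0) [Ring A] [Algebra K A]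
    [IsSemisimpleRing A] (σ : A →ₗ[K] A) (hmul : ∀ x y : A, σ (x * y) = σ y * σ x)
    (hinvol : ∀ x : A, σ (σ x) = x) (I : Ideal A) (h1 : ∀ a ∈ I, ∀ b ∈ I, a * σ b = 0)
    (h2 : ∀ c, (∀ a ∈ I, c * σ a = 0) → c ∈ I) : InvolutionHyperbolic (fun x => σ x : A → A) := by
  obtain ⟨f, hf, rfl⟩ := IsSemisimpleRing.ideal_eq_span_idempotent I
  have hff : f * f = f := hf
  have hfI : f ∈ Ideal.span {f} := Ideal.mem_span_singleton_self f
  have e0 : f * σ f = 0 := h1 f hfI f hfI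
  have hs : σ f * σ f = σ f := by rw [← hmul, hff]
  have h3 : 1 - σ f ∈ Ideal.span {f} := by
    apply h2
    intro a ha
    obtain ⟨r, rfl⟩ := Ideal.mem_span_singleton'.1 ha
    rw [hmul, ← mul_assoc, sub_mul, hs]; simp
  obtain ⟨r, hr⟩ := Ideal.mem_span_singleton'.1 h3
  have h4 : (1 - σ f) * f = 1 - σ f := by rw [← hr, mul_assoc, hff]
  rw [sub_mul, one_mul] at h4
  have h5 : σ f * f = f + σ f - 1 := by
    have h6 : σ f * f = f - (f - σ f * f) := by abel
    rw [h6, h4]; abel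
  refine ⟨f - (2⁻¹ : K) • (σ f * f), ?_, ?_⟩
  · have e1 : f * (σ f * f) = 0 := by rw [← mul_assoc, e0, zero_mul]
    have e2 : (σ f * f) * f = σ f * f := by rw [mul_assoc, hff]
    have e3 : (σ f * f) * (σ f * f) = 0 := by rw [mul_assoc, e1, mul_zero]
    simp [sub_mul, mul_sub, hff, e1, e2, e3]
  · simp only [map_sub, map_smul, hmul, hinvol]
    have : (2⁻¹ : K) • (σ f * f) + (2⁻¹ : K) • (σ f * f) = σ f * f := by
      rw [← add_smul, ← two_mul, mul_inv_cancel₀ hchar, one_smul]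
    calc _ = σ f + f - ((2⁻¹ : K) • (σ f * f) + (2⁻¹ : K) • (σ f * f)) := by abel
      _ = 1 := by rw [this, h5]; abel

theorem four_aux {R : Type*} [Ring R] (z : R) :
    (z - (1 - z)) * (z - (1 - z)) - 1 = 4 * (z * z) - 4 * z := by
  noncomm_ring

theorem lift_nil {K A : Type*} [Field K] (hchar : (2 : K) ≠ 0) [Ring A] [Algebra K A]
    (σ : A →ₗ[K] A) (hmul : ∀ x y : A, σ (x * y) = σ y * σ x) (k : ℕ) :
    ∀ (u : A), σ u = -u → (u * u - 1) ^ (k + 1) = 0 → ∃ v, σ v = - v ∧ v * v = 1 := by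
  have h1 : ∀ u : A, σ u = -u → σ (u * u) = u * u := by
    intro u hu; rw [hmul, hu]; simp
  induction k with
  | zero => intro u hu h; exact ⟨u, hu, by simpa [sub_eq_zero] using h⟩
  | succ k ih =>
    intro u hu h
    -- u' = u (1 - j/2) = u (3 - u²)/2
    set c : A := algebraMap K A 2⁻¹ with hc
    have hcc : c * 2 = 1 := by
      have : (2 : A) = algebraMap K A 2 := (map_ofNat _ 2).symm
      rw [this, hc, ← map_mul, inv_mul_cancel₀ hchar, map_one]
    have hcom : ∀ x, c * x = x * c := fun x => Algebra.commutes _ _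
    apply ih ((2⁻¹ : K) • (3 • u - u * u * u))
    · rw [map_smul, map_sub, map_nsmul, hmul, h1 u hu, hu, ← smul_neg]
      congr 1
      simp only [neg_mul, smul_neg, mul_assoc]
      abel
    · set j := u * u - 1 with hj
      have huu : u * u = 1 + j := by rw [hj]; abel
      have key : ((2⁻¹ : K) • (3 • u - u * u * u)) * ((2⁻¹ : K) • (3 • u - u * u * u)) - 1
          = j ^ 2 * (c * c * (j - 3)) := by
        have e4 : c * c * 4 = 1 := by
          have : (4 : A) = 2 * 2 := by norm_num
          rw [this, mul_assoc, ← mul_assoc c 2 2, hcc, one_mul, hcc]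
        have e5 : (3 • u - u * u * u) * (3 • u - u * u * u) =
            9 * (u * u) - 6 * (u * u) * (u * u) + (u * u) * (u * u) * (u * u) := by
          noncomm_ring
        have e6 : (2⁻¹ : K) • (2⁻¹ : K) • ((3 • u - u * u * u) * (3 • u - u * u * u)) =
            c * c * ((3 • u - u * u * u) * (3 • u - u * u * u)) := by
          rw [Algebra.smul_def, Algebra.smul_def, ← mul_assoc]
        rw [smul_mul_smul_comm, mul_smul, e6, e5, huu]
        have e7 : j ^ 2 * (c * c * (j - 3)) = c * c * (j ^ 2 * (j - 3)) := by
          have h2 : Commute (j ^ 2) c := (hcom _).symm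
          exact (h2.mul_right h2).left_comm (j - 3)
        rw [e7]
        have e8 : ∀ z : A, z - 1 = z - c * c * 4 := fun z => by rw [e4]
        have e9 : (4 : A) = 4 • 1 := by simp
        rw [e8, ← mul_sub, e9]
        congr 1
        noncomm_ring
      rw [key]
      have hcj : Commute j (c * c * (j - 3)) := by
        have h2 : Commute j c := (hcom j).symm
        exact (h2.mul_right h2).mul_right ((Commute.refl j).sub_right (Commute.ofNat_right j 3))
      rw [(hcj.pow_left 2).mul_pow, ← pow_mul, show 2 * (k+1) = (k+1+1) + k by ring, pow_add, h]
      simp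

theorem sigma_one {K A : Type*} [Field K] [Ring A] [Algebra K A]
    (σ : A →ₗ[K] A) (hmul : ∀ x y : A, σ (x * y) = σ y * σ x)
    (hinvol : ∀ x : A, σ (σ x) = x) : σ 1 = 1 := by
  have := hmul (σ 1) 1
  rw [mul_one, hinvol, mul_one] at this
  exact this.symm

theorem simple_semisimple {K A L : Type*} [Field K] (hchar : (2 : K) ≠ 0)
    [Ring A] [Algebra K A] [IsSemisimpleRing A]
    (σ : A →ₗ[K] A)
    (hmul : ∀ x y : A, σ (x * y) = σ y * σ x)
    (hinvol : ∀ x : A, σ (σ x) = x)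
    [Field L] [Algebra K L] (pb : PowerBasis K L)
    (hodd : Odd pb.dim)
    (h : InvolutionHyperbolic (LinearMap.rTensor L σ : A ⊗[K] L → A ⊗[K] L)) :
      InvolutionHyperbolic (fun x => σ x : A → A) := by
  obtain ⟨m, hm⟩ := hodd
  let τ : A ⊗[K] L →ₗ[K] A ⊗[K] L := LinearMap.rTensor L σ
  let b := Algebra.TensorProduct.basis A pb.basis
  let α : A ⊗[K] L := 1 ⊗ₜ pb.gen
  have hαp : ∀ i : ℕ, α ^ i = (1 : A) ⊗ₜ (pb.gen ^ i) := by
    intro i; simp [α, Algebra.TensorProduct.tmul_pow]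
  have hb : ∀ i, b i = α ^ (i : ℕ) := by
    intro i; rw [hαp]; simp [b]
  let S : A ⊗[K] L →ₗ[A] A := b.coord ⟨2 * m, by omega⟩
  have hSb : ∀ i (hi : i < pb.dim), S (α ^ i) = if i = 2 * m then 1 else 0 := by
    intro i hi
    have := hb ⟨i, hi⟩
    simp only at this
    rw [← this]
    simp only [S, Basis.coord_apply, Basis.repr_self, Finsupp.single_apply, Fin.mk.injEq]
  obtain ⟨I, hI1, hI2⟩ := core_ideal (A := A) (B := A ⊗[K] L) σ.toAddMonoidHom τ.toAddMonoidHom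
    (by
      intro x y
      change τ (x * y) = τ y * τ x
      induction x using TensorProduct.induction_on with
      | zero => simp
      | add x1 x2 h1 h2 => rw [add_mul, map_add, h1, h2, map_add, mul_add]
      | tmul a l =>
        induction y using TensorProduct.induction_on with
        | zero => simp
        | add x1 x2 h1 h2 => rw [mul_add, map_add, h1, h2, map_add, add_mul]
        | tmul c l' => simp [τ, hmul, mul_comm])
    (by
      intro x
      change τ (τ x) = x
      induction x using TensorProduct.induction_on with
      | zero => simp
      | add x1 x2 h1 h2 => rw [map_add, map_add, h1, h2]
      | tmul a l => simp [τ, hinvol])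
    α
    (by
      intro i x a
      rw [hαp]
      induction x using TensorProduct.induction_on with
      | zero => simp
      | add x1 x2 h1 h2 => rw [smul_add, mul_add, h1, h2, mul_add, smul_add]
      | tmul c l => simp [TensorProduct.smul_tmul'])
    (by
      intro i x
      rw [hαp]
      induction x using TensorProduct.induction_on with
      | zero => simp
      | add x1 x2 h1 h2 => rw [mul_add, h1, h2, add_mul]
      | tmul c l => simp [mul_comm])
    (by
      intro a i
      change τ (a • α ^ i) = σ a • α ^ i
      rw [hαp]
      simp [τ, TensorProduct.smul_tmul'])
    m S
    (by intro i hi; rw [hSb i (by omega), if_neg (by omega)])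
    (by intro i hi; rw [hSb i (by omega), if_pos (by omega)])
    (by
      rw [eq_top_iff, ← b.span_eq]
      apply Submodule.span_mono
      rintro _ ⟨i, rfl⟩
      exact ⟨i, by have := i.2; omega, hb i⟩)
    h
  exact core_semisimple hchar σ hmul hinvol I hI1 hI2

theorem simple_step {K A L : Type*} [Field K] (hchar : (2 : K) ≠ 0)
    [Ring A] [Algebra K A] [FiniteDimensional K A]
    (σ : A →ₗ[K] A)
    (hmul : ∀ x y : A, σ (x * y) = σ y * σ x)
    (hinvol : ∀ x : A, σ (σ x) = x)
    [Field L] [Algebra K L] (pb : PowerBasis K L)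
    (hodd : Odd pb.dim)
    (h : InvolutionHyperbolic (LinearMap.rTensor L σ : A ⊗[K] L → A ⊗[K] L)) :
      InvolutionHyperbolic (fun x => σ x : A → A) := by
  have hart : IsArtinianRing A := IsArtinianRing.of_finite K A
  have hσ1 := sigma_one σ hmul hinvol
  set J := Ring.jacobson A with hJ
  have hnil : ∀ x ∈ J, IsNilpotent x := by
    intro x hx
    obtain ⟨n, hn⟩ := IsSemiprimaryRing.isNilpotent (R := A)
    refine ⟨n, ?_⟩
    have := Ideal.pow_mem_pow hx n
    rw [hJ, hn] at this
    simpa using this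
  have hσp : ∀ (x : A) n, σ (x ^ n) = σ x ^ n := by
    intro x n
    induction n with
    | zero => simp [hσ1]
    | succ n ih => rw [pow_succ, hmul, ih, ← pow_succ']
  have hσJ : ∀ x ∈ J, σ x ∈ J := by
    intro x hx
    rw [hJ, ← Ideal.jacobson_bot, Ideal.mem_jacobson_iff]
    intro y
    have h1 : IsNilpotent (y * σ x) := by
      obtain ⟨n, hn⟩ := hnil (x * σ y) (Ideal.IsTwoSided.mul_mem_of_left _ hx)
      refine ⟨n, ?_⟩
      rw [← hinvol y, ← hmul, ← hσp, hn, map_zero]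
    obtain ⟨v, hv⟩ := h1.isUnit_add_one
    refine ⟨(v⁻¹ : Aˣ), ?_⟩
    have : ((v⁻¹ : Aˣ) : A) * (y * σ x + 1) = 1 := by rw [← hv]; simp
    rw [mul_add, mul_one, ← mul_assoc] at this
    simp [this]
  let q : A →ₐ[K] A ⧸ J := Ideal.Quotient.mkₐ K J
  have hq : Function.Surjective q := Ideal.Quotient.mk_surjective
  have hqJ : ∀ x, q x = 0 ↔ x ∈ J := fun x => Ideal.Quotient.eq_zero_iff_mem
  let g : A →+* (A ⧸ J)ᵐᵒᵖ :=
    { toFun := fun x => MulOpposite.op (q (σ x))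
      map_one' := by simp [hσ1]
      map_mul' := by intro x y; rw [hmul, map_mul, MulOpposite.op_mul]
      map_zero' := by simp
      map_add' := by intro x y; simp }
  let gb : A ⧸ J →+* (A ⧸ J)ᵐᵒᵖ := Ideal.Quotient.lift J g (by
    intro a ha
    change MulOpposite.op (q (σ a)) = 0
    rw [(hqJ _).2 (hσJ a ha)]; simp)
  have hgb : ∀ x, gb (q x) = MulOpposite.op (q (σ x)) := fun x => rfl
  let σb : A ⧸ J →ₗ[K] A ⧸ J :=
    { toFun := fun x => (gb x).unop
      map_add' := by intro x y; simp
      map_smul' := by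
        intro c x
        obtain ⟨x, rfl⟩ := hq x
        rw [← map_smul, hgb, hgb]
        simp }
  have hσb : ∀ x, σb (q x) = q (σ x) := fun x => rfl
  have hsem : IsSemisimpleRing (A ⧸ J) := IsSemiprimaryRing.isSemisimpleRing
  have hh : InvolutionHyperbolic (fun x => σb x : A ⧸ J → A ⧸ J) := by
    apply simple_semisimple hchar σb _ _ pb hodd
    · refine hyp_transport _ _ (Algebra.TensorProduct.map q (AlgHom.id K L)).toRingHom ?_ h
      intro x
      change Algebra.TensorProduct.map q (AlgHom.id K L) _ = σb.rTensor L (Algebra.TensorProduct.map q (AlgHom.id K L) x)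
      induction x using TensorProduct.induction_on with
      | zero => simp
      | add x1 x2 h1 h2 => simp only [map_add, h1, h2]
      | tmul a l => simp [hσb]
    · intro x y
      obtain ⟨x, rfl⟩ := hq x
      obtain ⟨y, rfl⟩ := hq y
      rw [← map_mul, hσb, hmul, map_mul, hσb, hσb]
    · intro x
      obtain ⟨x, rfl⟩ := hq x
      rw [hσb, hσb, hinvol]
  obtain ⟨e, he, hes⟩ := hh
  obtain ⟨e, rfl⟩ := hq e
  have hes' : q (σ e) = 1 - q e := by
    rw [← hes]; simp [hσb]
  have hu : σ (e - σ e) = - (e - σ e) := by rw [map_sub, hinvol]; abel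
  have huJ : (e - σ e) * (e - σ e) - 1 ∈ J := by
    rw [← hqJ, map_sub, map_mul, map_sub, hes', map_one]
    have : (q e - (1 - q e)) * (q e - (1 - q e)) - 1 = 4 * (q e * q e) - 4 * q e := four_aux (q e)
    rw [this, he]; simp
  obtain ⟨k, hk⟩ := hnil _ huJ
  obtain ⟨v, hv, hvv⟩ := lift_nil hchar σ hmul k _ hu (by rw [pow_succ, hk, zero_mul])
  have h2 : ∀ x : A, (2⁻¹ : K) • (x + x) = x := by
    intro x
    rw [← two_smul K x, smul_smul, inv_mul_cancel₀ hchar, one_smul]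
  refine ⟨(2⁻¹ : K) • (1 + v), ?_, ?_⟩
  · rw [smul_mul_smul_comm, mul_smul]
    congr 1
    refine Eq.trans ?_ (h2 (1 + v))
    congr 1
    rw [add_mul, mul_add, mul_add, hvv]; simp; abel
  · simp only [map_smul, map_add, hσ1, hv]
    rw [← smul_add, ← h2 1]
    congr 1
    rw [h2]; abel

theorem tower_step {K A F E : Type*} [Field K] (hchar : (2 : K) ≠ 0)
    [Ring A] [Algebra K A] [FiniteDimensional K A]
    (σ : A →ₗ[K] A)
    (hmul : ∀ x y : A, σ (x * y) = σ y * σ x)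
    (hinvol : ∀ x : A, σ (σ x) = x)
    [Field F] [Algebra K F] [Field E] [Algebra K E] [Algebra F E] [IsScalarTower K F E]
    (pb : PowerBasis F E) (hodd : Odd pb.dim)
    (h : InvolutionHyperbolic (LinearMap.lTensor E σ : E ⊗[K] A → E ⊗[K] A)) :
      InvolutionHyperbolic (LinearMap.lTensor F σ : F ⊗[K] A → F ⊗[K] A) := by
  have hcharF : (2 : F) ≠ 0 := by
    rw [← map_ofNat (algebraMap K F) 2]
    simpa using hchar
  let τ : F ⊗[K] A →ₗ[F] F ⊗[K] A := σ.baseChange F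
  have key := simple_step hcharF τ
    (by
      intro x y
      induction x using TensorProduct.induction_on with
      | zero => simp
      | add x1 x2 h1 h2 => rw [add_mul, map_add, h1, h2, map_add, mul_add]
      | tmul a l =>
        induction y using TensorProduct.induction_on with
        | zero => simp
        | add x1 x2 h1 h2 => rw [mul_add, map_add, h1, h2, map_add, add_mul]
        | tmul c l' => simp [τ, hmul, mul_comm])
    (by
      intro x
      induction x using TensorProduct.induction_on with
      | zero => simp
      | add x1 x2 h1 h2 => rw [map_add, map_add, h1, h2]
      | tmul a l => simp [τ, hinvol])
    pb hodd
  refine key ?_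
  let f1 : E →ₐ[K] (F ⊗[K] A) ⊗[F] E :=
    (Algebra.TensorProduct.includeRight : E →ₐ[F] (F ⊗[K] A) ⊗[F] E).restrictScalars K
  let f2 : A →ₐ[K] (F ⊗[K] A) ⊗[F] E :=
    ((Algebra.TensorProduct.includeLeft : (F ⊗[K] A) →ₐ[F] (F ⊗[K] A) ⊗[F] E).restrictScalars K).comp
      Algebra.TensorProduct.includeRight
  let f : E ⊗[K] A →ₐ[K] (F ⊗[K] A) ⊗[F] E := Algebra.TensorProduct.lift f1 f2
    (by intro x y; simp [f1, f2, Commute, SemiconjBy])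
  have hf : ∀ l a, f (l ⊗ₜ a) = ((1 : F) ⊗ₜ[K] a) ⊗ₜ[F] l := by
    intro l a
    change f1 l * f2 a = _
    simp [f1, f2]
  refine hyp_transport _ _ f.toRingHom ?_ h
  intro x
  change f _ = τ.rTensor E (f x)
  induction x using TensorProduct.induction_on with
  | zero => simp
  | add x1 x2 h1 h2 => simp only [map_add, h1, h2]
  | tmul l a => simp [hf, τ]

theorem statement13 {K A L : Type*} [Field K] (hchar : (2 : K) ≠ 0)
    [Ring A] [Algebra K A] [FiniteDimensional K A]
    (σ : A →ₗ[K] A)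
    (hmul : ∀ x y : A, σ (x * y) = σ y * σ x)
    (hinvol : ∀ x : A, σ (σ x) = x)
    [Field L] [Algebra K L] [FiniteDimensional K L]
    (hodd : Odd (Module.finrank K L)) :
    InvolutionHyperbolic (LinearMap.rTensor L σ : A ⊗[K] L → A ⊗[K] L) ↔
      InvolutionHyperbolic (fun x => σ x : A → A) := by
  constructor
  · intro h
    have main : ∀ F : IntermediateField K L,
        InvolutionHyperbolic (LinearMap.lTensor F σ : F ⊗[K] A → F ⊗[K] A) →
        InvolutionHyperbolic (fun x => σ x : A → A) := by
      intro F
      induction F using IntermediateField.induction_on_adjoin with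
      | base =>
        intro h
        let f : (⊥ : IntermediateField K L) ⊗[K] A →ₐ[K] A :=
          (Algebra.TensorProduct.lid K A).toAlgHom.comp
            (Algebra.TensorProduct.map (IntermediateField.botEquiv K L).toAlgHom (AlgHom.id K A))
        refine hyp_transport _ _ f.toRingHom ?_ h
        intro x
        change f _ = σ (f x)
        induction x using TensorProduct.induction_on with
        | zero => simp
        | add x1 x2 h1 h2 => simp only [map_add, h1, h2]
        | tmul l a => simp [f]
      | ih F x ih =>
        intro h
        apply ih
        have hx : IsIntegral F x := Algebra.IsIntegral.isIntegral x
        refine tower_step (E := IntermediateField.adjoin F {x}) hchar σ hmul hinvol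
          (IntermediateField.adjoin.powerBasis hx) ?_ h
        rw [← PowerBasis.finrank]
        have h1 := Module.finrank_mul_finrank K F L
        have h2 := Module.finrank_mul_finrank F (IntermediateField.adjoin F {x}) L
        rw [← h1, ← h2] at hodd
        exact (Nat.odd_mul.1 (Nat.odd_mul.1 hodd).2).1
    apply main ⊤
    let f : A ⊗[K] L →ₐ[K] (⊤ : IntermediateField K L) ⊗[K] A :=
      (Algebra.TensorProduct.map (IntermediateField.topEquiv (F := K) (E := L)).symm.toAlgHom
        (AlgHom.id K A)).comp (Algebra.TensorProduct.comm K A L).toAlgHom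
    refine hyp_transport _ _ f.toRingHom ?_ h
    intro x
    change f _ = LinearMap.lTensor _ σ (f x)
    induction x using TensorProduct.induction_on with
    | zero => simp
    | add x1 x2 h1 h2 => simp only [map_add, h1, h2]
    | tmul a l => simp [f]
  · intro h
    refine hyp_transport _ _ (Algebra.TensorProduct.includeLeft : A →ₐ[K] A ⊗[K] L).toRingHom ?_ h
    intro x
    simp
end
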